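/- Let O occupy a straight line of nodes in G_eqt, and let P consist of contracted particles occupying every node of layer 1 except one node below O equidistant from its two ends, together with one additional particle in layer 2 above O equidistant from its two ends. Then the coating problem for (P,O) can be solved in 5 rounds while keeping the particle system connected throughout; in particular OPT(P,O) = O(1), independent of the length of O. -/

import Mathlib

/-- Nodes of the infinite regular triangular grid, realized on `ℤ × ℤ`. -/
abbrev Node : Type := ℤ × ℤ

/-- The infinite regular triangular grid graph `G_eqt`. -/
def Geqt : SimpleGraph Node :=
  SimpleGraph.fromRel (fun u v =>
    (v.1 - u.1, v.2 - u.2) ∈ ({(1, 0), (0, 1), (1, -1)} : Set (ℤ × ℤ)))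

/-- Graph distance in the triangular grid. -/
noncomputable def gdist (u v : Node) : ℕ := Geqt.dist u v

/-- Distance from a node to a set of nodes. -/
noncomputable def gdistSet (v : Node) (U : Set Node) : ℕ := sInf (gdist v '' U)

/-- A coating instance: the initial (contracted) particle positions and an object. -/
structure Instance where
  particles : Set Node
  object : Set Node

/-- Layer `i`: the set of nodes at distance `i` from the object. -/
def layer (O : Set Node) (i : ℕ) : Set Node := {v | gdistSet v O = i}

/-- `B O i` is the number of nodes in layer `i`. -/
noncomputable def B (O : Set Node) (i : ℕ) : ℕ := (layer O i).ncard

/-- The subgraph of `G_eqt` induced by `S` is connected. -/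
def connectedSet (S : Set Node) : Prop := (Geqt.induce S).Connected

/-- `S` is `k`-connected: removing fewer than `k` nodes leaves it connected. -/
def kConnectedSet (k : ℕ) (S : Set Node) : Prop :=
  ∀ D : Set Node, D ⊆ S → D.Finite → D.ncard < k → connectedSet (S \ D)

/-- A valid instance for the universal coating problem: finitely many particles,
all initially contracted (and idle), a single connected object, the particle
system connected to the object, no holes in the object, and no narrow tunnels. -/
def ValidInstance (I : Instance) : Prop :=
  I.particles.Finite ∧ I.particles.Nonempty ∧
  I.particles ∩ I.object = ∅ ∧
  connectedSet I.object ∧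
  connectedSet (I.particles ∪ I.object) ∧
  connectedSet I.objectᶜ ∧
  kConnectedSet (2 * (⌈(I.particles.ncard : ℚ) / (B I.object 1 : ℚ)⌉₊ + 1)) I.objectᶜ

/-- A set of occupied nodes is a legal coating configuration: every unoccupied
non-object node is at least as far from the object as every occupied node. -/
def legal (I : Instance) (S : Set Node) : Prop :=
  ∀ v, v ∉ I.object → v ∉ S → ∀ w ∈ S, gdistSet w I.object ≤ gdistSet v I.object

/-- The particles of an instance, as a type. -/
abbrev Pt (I : Instance) : Type := {v : Node // v ∈ I.particles}

/-- The nodes occupied by a particle given as a (tail, head) pair. -/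
def nodesOf (q : Node × Node) : Set Node := {q.1, q.2}

/-- A particle is contracted if its tail and head coincide. -/
def Contracted (q : Node × Node) : Prop := q.1 = q.2

/-- In one round a particle performs at most one movement:
it stays put, performs a single expansion, or a single contraction. -/
def MoveStep (a b : Node × Node) : Prop :=
  b = a
  ∨ (Contracted a ∧ b.1 = a.1 ∧ Geqt.Adj a.2 b.2)
  ∨ (¬ Contracted a ∧ b = (a.2, a.2))

/-- The set of nodes occupied by the particle system at round `t`. -/
def occupiedAt (I : Instance) (e : ℕ → Pt I → Node × Node) (t : ℕ) : Set Node :=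
  ⋃ p : Pt I, nodesOf (e t p)

/-- An execution: all particles start contracted at their initial positions,
occupy one node or two adjacent nodes, perform at most one movement per round,
never collide with each other, and never enter the object. -/
def IsExec (I : Instance) (e : ℕ → Pt I → Node × Node) : Prop :=
  (∀ p, e 0 p = (p.1, p.1)) ∧
  (∀ t p, Contracted (e t p) ∨ Geqt.Adj (e t p).1 (e t p).2) ∧
  (∀ t p, MoveStep (e t p) (e (t + 1) p)) ∧
  (∀ t p q, p ≠ q → nodesOf (e t p) ∩ nodesOf (e t q) = ∅) ∧
  (∀ t, occupiedAt I e t ∩ I.object = ∅)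

/-- An execution keeps the particle system (together with the object) connected. -/
def ConnectedExec (I : Instance) (e : ℕ → Pt I → Node × Node) : Prop :=
  ∀ t, connectedSet (occupiedAt I e t ∪ I.object)

/-- The execution solves the coating problem by round `T`: all particles are
contracted, the configuration is legal, and it is stable from then on. -/
def SolvesIn (I : Instance) (e : ℕ → Pt I → Node × Node) (T : ℕ) : Prop :=
  (∀ p, Contracted (e T p)) ∧ legal I (occupiedAt I e T) ∧ ∀ t, T ≤ t → e t = e T

/-- `OPT I`: the minimum number of rounds in which any (connectivity-preserving)
sequence of particle movements solves the coating instance `I`. -/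
noncomputable def OPT (I : Instance) : ℕ∞ :=
  sInf {T : ℕ∞ | ∃ T' : ℕ, T = (T' : ℕ∞) ∧
    ∃ e, IsExec I e ∧ ConnectedExec I e ∧ SolvesIn I e T'}

/-- The object: a straight line of `2m + 1` nodes in `G_eqt`. -/
def lineObject (m : ℕ) : Set Node := {v | ∃ x : ℤ, 0 ≤ x ∧ x ≤ 2 * (m : ℤ) ∧ v = (x, 0)}

/-- The particles: every node of layer 1 except the node `(m, -1)` below the
object (equidistant from its two ends), plus one extra particle at `(m, 2)`
in layer 2 above the object (equidistant from its two ends). -/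
def lineParticles (m : ℕ) : Set Node :=
  (layer (lineObject m) 1 \ {((m : ℤ), (-1 : ℤ))}) ∪ {((m : ℤ), (2 : ℤ))}

/-- The lower-bound instance from the competitiveness proof. -/
def lineInstance (m : ℕ) : Instance := ⟨lineParticles m, lineObject m⟩

theorem adj_iff (u v : Node) : Geqt.Adj u v ↔
    ((v.1 - u.1 = 1 ∧ v.2 - u.2 = 0) ∨ (v.1 - u.1 = 0 ∧ v.2 - u.2 = 1) ∨
     (v.1 - u.1 = 1 ∧ v.2 - u.2 = -1) ∨ (v.1 - u.1 = -1 ∧ v.2 - u.2 = 0) ∨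
     (v.1 - u.1 = 0 ∧ v.2 - u.2 = -1) ∨ (v.1 - u.1 = -1 ∧ v.2 - u.2 = 1)) := by
  obtain ⟨a, b⟩ := u
  obtain ⟨c, d⟩ := v
  simp only [Geqt, SimpleGraph.fromRel_adj, Set.mem_insert_iff, Set.mem_singleton_iff,
    Prod.mk.injEq, ne_eq]
  omega

theorem geqt_reach (a b : ℤ) : Geqt.Reachable (a, b) (0, 0) := by
  have h1 : ∀ a b : ℤ, Geqt.Reachable (a, b) (a + 1, b) := fun a b =>
    SimpleGraph.Adj.reachable ((adj_iff _ _).2 (by simp))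
  have h2 : ∀ a b : ℤ, Geqt.Reachable (a, b) (a, b + 1) := fun a b =>
    SimpleGraph.Adj.reachable ((adj_iff _ _).2 (by simp))
  have hx : ∀ a : ℤ, Geqt.Reachable (a, 0) (0, 0) := by
    intro a
    induction a using Int.induction_on with
    | zero => exact SimpleGraph.Reachable.refl _
    | succ i ih => exact (h1 _ _).symm.trans ih
    | pred i ih =>
      have := h1 (-(i : ℤ) - 1) 0
      rw [sub_add_cancel] at this
      exact this.trans ih
  induction b using Int.induction_on with
  | zero => exact hx a
  | succ i ih => exact (h2 _ _).symm.trans ih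
  | pred i ih =>
    have := h2 a (-(i : ℤ) - 1)
    rw [sub_add_cancel] at this
    exact this.trans ih

theorem geqt_conn : Geqt.Connected := by
  have : Nonempty Node := ⟨(0, 0)⟩
  refine SimpleGraph.Connected.mk fun u v => ?_
  exact (geqt_reach u.1 u.2).trans (geqt_reach v.1 v.2).symm

theorem mem_line (m : ℕ) (v : Node) : v ∈ lineObject m ↔ 0 ≤ v.1 ∧ v.1 ≤ 2 * (m : ℤ) ∧ v.2 = 0 := by
  obtain ⟨a, b⟩ := v
  constructor
  · rintro ⟨x, h0, h1, h2⟩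
    simp only [Prod.mk.injEq] at h2
    omega
  · rintro ⟨h0, h1, h2⟩
    simp only at h0 h1 h2
    exact ⟨a, h0, h1, by rw [h2]⟩

theorem gdistSet_pos (m : ℕ) (v : Node) (h : v ∉ lineObject m) :
    1 ≤ gdistSet v (lineObject m) := by
  by_contra hc
  have h0 : sInf (gdist v '' lineObject m) = 0 := by
    have : gdistSet v (lineObject m) = 0 := by omega
    exact this
  rcases Nat.sInf_eq_zero.1 h0 with h1 | h1
  · obtain ⟨w, hw, hd⟩ := h1
    have := geqt_conn.dist_eq_zero_iff.1 hd
    exact h (this ▸ hw)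
  · have : ((0 : ℤ), (0 : ℤ)) ∈ lineObject m := (mem_line m _).2 ⟨le_refl _, by simp, rfl⟩
    have h2 := Set.mem_image_of_mem (gdist v) this
    rw [h1] at h2
    exact h2

theorem gdistSet_le (m : ℕ) (v w : Node) (hw : w ∈ lineObject m) (h : Geqt.Adj v w) :
    gdistSet v (lineObject m) ≤ 1 := by
  refine Nat.sInf_le ⟨w, hw, ?_⟩
  exact SimpleGraph.dist_eq_one_iff_adj.2 h

theorem mem_layer (m : ℕ) (v : Node) : v ∈ layer (lineObject m) 1 ↔
    ((v.2 = 1 ∧ -1 ≤ v.1 ∧ v.1 ≤ 2 * (m : ℤ)) ∨ (v.2 = -1 ∧ 0 ≤ v.1 ∧ v.1 ≤ 2 * (m : ℤ) + 1) ∨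
     (v.2 = 0 ∧ (v.1 = -1 ∨ v.1 = 2 * (m : ℤ) + 1))) := by
  constructor
  · intro h
    have h1 : sInf (gdist v '' lineObject m) = 1 := h
    have hne : (gdist v '' lineObject m).Nonempty := by
      rw [Set.nonempty_iff_ne_empty]
      intro h2
      rw [h2] at h1
      simp at h1
    have h3 := Nat.sInf_mem hne
    rw [h1] at h3
    obtain ⟨w, hw, hd⟩ := h3
    have hadj := (adj_iff _ _).1 (SimpleGraph.dist_eq_one_iff_adj.1 hd)
    have hv : v ∉ lineObject m := by
      intro hv
      have : gdistSet v (lineObject m) ≤ 0 := by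
        refine Nat.sInf_le ⟨v, hv, ?_⟩
        simp [gdist]
      have h4 : gdistSet v (lineObject m) = 1 := h
      omega
    rw [mem_line] at hw hv
    omega
  · intro h
    have hv : v ∉ lineObject m := by
      rw [mem_line]; omega
    have h1 := gdistSet_pos m v hv
    have h2 : ∃ w, w ∈ lineObject m ∧ Geqt.Adj v w := by
      simp only [mem_line, adj_iff]
      rcases h with ⟨h, h', h''⟩ | ⟨h, h', h''⟩ | ⟨h, h' | h'⟩
      · by_cases hz : v.1 = -1
        · exact ⟨(v.1 + 1, 0), by dsimp only; omega⟩
        · exact ⟨(v.1, 0), by dsimp only; omega⟩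
      · by_cases hz : v.1 = 0
        · exact ⟨(v.1, 0), by dsimp only; omega⟩
        · exact ⟨(v.1 - 1, 0), by dsimp only; omega⟩
      · exact ⟨(v.1 + 1, 0), by dsimp only; omega⟩
      · exact ⟨(v.1 - 1, 0), by dsimp only; omega⟩
    obtain ⟨w, hw, ha⟩ := h2
    have h3 := gdistSet_le m v w hw ha
    exact le_antisymm h3 h1

theorem mem_parts (m : ℕ) (v : Node) : v ∈ lineParticles m ↔
    ((v.2 = 1 ∧ -1 ≤ v.1 ∧ v.1 ≤ 2 * (m : ℤ)) ∨
     (v.2 = -1 ∧ 0 ≤ v.1 ∧ v.1 ≤ 2 * (m : ℤ) + 1 ∧ v.1 ≠ m) ∨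
     (v.2 = 0 ∧ (v.1 = -1 ∨ v.1 = 2 * (m : ℤ) + 1)) ∨ (v.2 = 2 ∧ v.1 = m)) := by
  obtain ⟨a, b⟩ := v
  simp only [lineParticles, Set.mem_union, Set.mem_sdiff, mem_layer, Set.mem_singleton_iff,
    Prod.mk.injEq]
  omega

/-- The schedule: positions of the particle starting at `v` at the end of round `t`. -/
def sched (m : ℕ) (t : ℕ) (v : Node) : Node × Node :=
  if t = 0 then (v, v)
  else if v.2 = 1 ∧ (m : ℤ) + 1 ≤ v.1 ∧ v.1 ≤ 2 * (m : ℤ) - 1 then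
    (if t = 1 then (v, (v.1, 2)) else if t = 2 then ((v.1, 2), (v.1, 2))
     else if t = 3 then ((v.1, 2), (v.1 + 1, 1)) else ((v.1 + 1, 1), (v.1 + 1, 1)))
  else if v.2 = 1 ∧ v.1 = 2 * (m : ℤ) then
    (if t = 1 then (v, (v.1 + 1, 1)) else if t = 2 then ((v.1 + 1, 1), (v.1 + 1, 1))
     else if t = 3 then ((v.1 + 1, 1), (v.1 + 1, 0)) else ((v.1 + 1, 0), (v.1 + 1, 0)))
  else if v.2 = 0 ∧ v.1 = 2 * (m : ℤ) + 1 then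
    (if t = 1 then (v, v) else if t = 2 then (v, (v.1, -1)) else ((v.1, -1), (v.1, -1)))
  else if v.2 = -1 ∧ (m : ℤ) + 2 ≤ v.1 then
    (if t = 1 then (v, (v.1, -2)) else if t = 2 then ((v.1, -2), (v.1, -2))
     else if t = 3 then ((v.1, -2), (v.1 - 1, -1)) else ((v.1 - 1, -1), (v.1 - 1, -1)))
  else if v.2 = -1 ∧ v.1 = (m : ℤ) + 1 then
    (if t ≤ 2 then (v, (v.1 - 1, -1)) else ((v.1 - 1, -1), (v.1 - 1, -1)))
  else if v.2 = 2 then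
    (if t ≤ 2 then (v, v) else if t = 3 then (v, (v.1 + 1, 1))
     else ((v.1 + 1, 1), (v.1 + 1, 1)))
  else (v, v)

theorem sched_four (m t : ℕ) (ht : 4 ≤ t) (v : Node) : sched m t v = sched m 4 v := by
  have h0 : t ≠ 0 := by omega
  have h1 : t ≠ 1 := by omega
  have h2 : t ≠ 2 := by omega
  have h3 : t ≠ 3 := by omega
  have h4 : ¬ t ≤ 2 := by omega
  simp [sched, h0, h1, h2, h3, h4]

theorem t_cases (t : ℕ) : t = 0 ∨ t = 1 ∨ t = 2 ∨ t = 3 ∨ 4 ≤ t := by omega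

/-- The stationary particles. -/
def Stay (m : ℕ) (v : Node) : Prop :=
  (v.2 = 1 ∧ -1 ≤ v.1 ∧ v.1 ≤ m) ∨ (v.2 = -1 ∧ 0 ≤ v.1 ∧ v.1 < m) ∨ (v.2 = 0 ∧ v.1 = -1)

theorem part_cases (m : ℕ) (v : Node) (hv : v ∈ lineParticles m) :
    (∃ a : ℤ, (m : ℤ) + 1 ≤ a ∧ a ≤ 2 * (m : ℤ) - 1 ∧ v = (a, 1)) ∨
    v = (2 * (m : ℤ), 1) ∨ v = (2 * (m : ℤ) + 1, 0) ∨
    (∃ a : ℤ, (m : ℤ) + 2 ≤ a ∧ a ≤ 2 * (m : ℤ) + 1 ∧ v = (a, -1)) ∨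
    v = ((m : ℤ) + 1, -1) ∨ v = ((m : ℤ), 2) ∨ Stay m v := by
  rw [mem_parts] at hv
  obtain ⟨a, b⟩ := v
  simp only [Stay, Prod.mk.injEq] at hv ⊢
  rcases hv with ⟨h, h1, h2⟩ | ⟨h, h1, h2, h3⟩ | ⟨h, h1 | h1⟩ | ⟨h, h1⟩
  · by_cases h3 : a ≤ m
    · omega
    · by_cases h4 : a = 2 * m
      · omega
      · exact Or.inl ⟨a, by omega, by omega, rfl, h⟩
  · by_cases h3 : a < m
    · omega
    · by_cases h4 : a = m + 1
      · omega
      · exact Or.inr (Or.inr (Or.inr (Or.inl ⟨a, by omega, by omega, rfl, h⟩)))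
  · omega
  · omega
  · omega

theorem sched_top (m t : ℕ) (a : ℤ) (h1 : (m : ℤ) + 1 ≤ a) (h2 : a ≤ 2 * (m : ℤ) - 1) :
    sched m t (a, 1) = if t = 0 then ((a, 1), (a, 1)) else if t = 1 then ((a, 1), (a, 2))
      else if t = 2 then ((a, 2), (a, 2)) else if t = 3 then ((a, 2), (a + 1, 1))
      else ((a + 1, 1), (a + 1, 1)) := by
  simp only [sched]
  rw [if_pos (⟨trivial, h1, h2⟩ : True ∧ _)]

theorem sched_c1 (m t : ℕ) :
    sched m t (2 * (m : ℤ), 1) = if t = 0 then ((2 * (m : ℤ), 1), (2 * (m : ℤ), 1))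
      else if t = 1 then ((2 * (m : ℤ), 1), (2 * (m : ℤ) + 1, 1))
      else if t = 2 then ((2 * (m : ℤ) + 1, 1), (2 * (m : ℤ) + 1, 1))
      else if t = 3 then ((2 * (m : ℤ) + 1, 1), (2 * (m : ℤ) + 1, 0))
      else ((2 * (m : ℤ) + 1, 0), (2 * (m : ℤ) + 1, 0)) := by
  simp [sched]

theorem sched_c2 (m t : ℕ) :
    sched m t (2 * (m : ℤ) + 1, 0) =
      if t = 0 then ((2 * (m : ℤ) + 1, 0), (2 * (m : ℤ) + 1, 0))
      else if t = 1 then ((2 * (m : ℤ) + 1, 0), (2 * (m : ℤ) + 1, 0))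
      else if t = 2 then ((2 * (m : ℤ) + 1, 0), (2 * (m : ℤ) + 1, -1))
      else ((2 * (m : ℤ) + 1, -1), (2 * (m : ℤ) + 1, -1)) := by
  simp [sched]

theorem sched_bot (m t : ℕ) (a : ℤ) (h1 : (m : ℤ) + 2 ≤ a) :
    sched m t (a, -1) = if t = 0 then ((a, -1), (a, -1)) else if t = 1 then ((a, -1), (a, -2))
      else if t = 2 then ((a, -2), (a, -2)) else if t = 3 then ((a, -2), (a - 1, -1))
      else ((a - 1, -1), (a - 1, -1)) := by
  simp [sched, h1]

theorem sched_f (m t : ℕ) :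
    sched m t ((m : ℤ) + 1, -1) = if t = 0 then (((m : ℤ) + 1, -1), ((m : ℤ) + 1, -1))
      else if t ≤ 2 then (((m : ℤ) + 1, -1), ((m : ℤ), -1))
      else (((m : ℤ), -1), ((m : ℤ), -1)) := by
  simp [sched]

theorem sched_e (m t : ℕ) :
    sched m t ((m : ℤ), 2) = if t ≤ 2 then (((m : ℤ), 2), ((m : ℤ), 2))
      else if t = 3 then (((m : ℤ), 2), ((m : ℤ) + 1, 1))
      else (((m : ℤ) + 1, 1), ((m : ℤ) + 1, 1)) := by
  by_cases h : t = 0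
  · subst h; simp [sched]
  · simp [sched, h]

theorem sched_stay (m t : ℕ) (hm : 1 ≤ m) (v : Node) (h : Stay m v) : sched m t v = (v, v) := by
  unfold Stay at h
  simp only [sched]
  rw [if_neg (by omega : ¬ (v.2 = 1 ∧ (m : ℤ) + 1 ≤ v.1 ∧ v.1 ≤ 2 * (m : ℤ) - 1)),
    if_neg (by omega : ¬ (v.2 = 1 ∧ v.1 = 2 * (m : ℤ))),
    if_neg (by omega : ¬ (v.2 = 0 ∧ v.1 = 2 * (m : ℤ) + 1)),
    if_neg (by omega : ¬ (v.2 = -1 ∧ (m : ℤ) + 2 ≤ v.1)),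
    if_neg (by omega : ¬ (v.2 = -1 ∧ v.1 = (m : ℤ) + 1)),
    if_neg (by omega : ¬ v.2 = 2), ite_self]

theorem contr_iff (q : Node × Node) : Contracted q ↔ q.1.1 = q.2.1 ∧ q.1.2 = q.2.2 := by
  simp [Contracted, Prod.ext_iff]

theorem move_iff (a b : Node × Node) : MoveStep a b ↔
    ((b.1.1 = a.1.1 ∧ b.1.2 = a.1.2 ∧ b.2.1 = a.2.1 ∧ b.2.2 = a.2.2) ∨
     (Contracted a ∧ (b.1.1 = a.1.1 ∧ b.1.2 = a.1.2) ∧ Geqt.Adj a.2 b.2) ∨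
     (¬ Contracted a ∧ (b.1.1 = a.2.1 ∧ b.1.2 = a.2.2 ∧ b.2.1 = a.2.1 ∧ b.2.2 = a.2.2))) := by
  simp [MoveStep, Prod.ext_iff, and_assoc]

theorem sched_move (m : ℕ) (t : ℕ) (v : Node) :
    MoveStep (sched m t v) (sched m (t + 1) v) := by
  rcases t_cases t with h | h | h | h | h
  rotate_left 4
  · rw [sched_four m t h, sched_four m (t + 1) (by omega)]
    exact Or.inl rfl
  all_goals
    subst h
    rw [move_iff]
    simp only [adj_iff, contr_iff, sched]
    simp
    split_ifs <;> simp <;> omega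

theorem sched_shape (m : ℕ) (t : ℕ) (v : Node) :
    Contracted (sched m t v) ∨ Geqt.Adj (sched m t v).1 (sched m t v).2 := by
  rcases t_cases t with h | h | h | h | h
  rotate_left 4
  · rw [sched_four m t h]
    simp only [adj_iff, contr_iff, sched]
    simp
    split_ifs <;> simp
  all_goals
    subst h
    simp only [adj_iff, contr_iff, sched]
    simp
    try (split_ifs <;> simp <;> omega)

/-- The particle occupying a node at the end of round 1. -/
def owner1 (m : ℕ) (n : Node) : Node :=
  if n.2 = 2 ∧ n.1 ≠ m then (n.1, 1) else if n.2 = 1 ∧ n.1 = 2 * (m : ℤ) + 1 then (n.1 - 1, 1)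
  else if n.2 = -2 then (n.1, -1) else if n.2 = -1 ∧ n.1 = m then (n.1 + 1, -1) else n

/-- The particle occupying a node at the end of round 2. -/
def owner2 (m : ℕ) (n : Node) : Node :=
  if n.2 = 2 ∧ n.1 ≠ m then (n.1, 1) else if n.2 = 1 ∧ n.1 = 2 * (m : ℤ) + 1 then (n.1 - 1, 1)
  else if n.2 = -2 then (n.1, -1) else if n.2 = -1 ∧ n.1 = m then (n.1 + 1, -1)
  else if n.2 = -1 ∧ n.1 = 2 * (m : ℤ) + 1 then (n.1, 0) else n

/-- The particle occupying a node from the end of round 3 on. -/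
def owner3 (m : ℕ) (n : Node) : Node :=
  if n.2 = 2 ∧ n.1 ≠ m then (n.1, 1) else if n.2 = 1 ∧ n.1 = 2 * (m : ℤ) + 1 then (n.1 - 1, 1)
  else if n.2 = -2 then (n.1, -1)
  else if n.2 = -1 ∧ n.1 = 2 * (m : ℤ) + 1 then (n.1, 0)
  else if n.2 = -1 ∧ (m : ℤ) ≤ n.1 then (n.1 + 1, -1)
  else if n.2 = 0 ∧ n.1 = 2 * (m : ℤ) + 1 then (n.1 - 1, 1)
  else if n.2 = 1 ∧ n.1 = (m : ℤ) + 1 then (n.1 - 1, 2)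
  else if n.2 = 1 ∧ (m : ℤ) + 2 ≤ n.1 then (n.1 - 1, 1) else n

theorem owner_sched1 (m : ℕ) (hm : 1 ≤ m) (v : Node) (hv : v ∈ lineParticles m) :
    owner1 m (sched m 1 v).1 = v ∧ owner1 m (sched m 1 v).2 = v := by
  rcases part_cases m v hv with ⟨a, h1, h2, rfl⟩ | rfl | rfl | ⟨a, h1, h2, rfl⟩ | rfl | rfl | hs
  · rw [sched_top m _ a h1 h2]
    constructor <;> norm_num [owner1] <;> (try split_ifs) <;> (try simp only [Prod.mk.injEq]) <;> first | omega | (intros; exfalso; omega) | grind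
  · rw [sched_c1]
    constructor <;> norm_num [owner1] <;> (try split_ifs) <;> (try simp only [Prod.mk.injEq]) <;> first | omega | (intros; exfalso; omega) | grind
  · rw [sched_c2]
    constructor <;> norm_num [owner1] <;> (try split_ifs) <;> (try simp only [Prod.mk.injEq]) <;> first | omega | (intros; exfalso; omega) | grind
  · rw [sched_bot m _ a h1]
    constructor <;> norm_num [owner1] <;> (try split_ifs) <;> (try simp only [Prod.mk.injEq]) <;> first | omega | (intros; exfalso; omega) | grind
  · rw [sched_f]
    constructor <;> norm_num [owner1] <;> (try split_ifs) <;> (try simp only [Prod.mk.injEq]) <;> first | omega | (intros; exfalso; omega) | grind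
  · rw [sched_e]
    constructor <;> norm_num [owner1] <;> (try split_ifs) <;> (try simp only [Prod.mk.injEq]) <;> first | omega | (intros; exfalso; omega) | grind
  · rw [sched_stay m _ hm v hs]
    unfold Stay at hs
    simp only [owner1, and_self]
    rcases hs with hs | hs | hs <;> (split_ifs <;> first | rfl | omega)

theorem owner_sched2 (m : ℕ) (hm : 1 ≤ m) (v : Node) (hv : v ∈ lineParticles m) :
    owner2 m (sched m 2 v).1 = v ∧ owner2 m (sched m 2 v).2 = v := by
  rcases part_cases m v hv with ⟨a, h1, h2, rfl⟩ | rfl | rfl | ⟨a, h1, h2, rfl⟩ | rfl | rfl | hs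
  · rw [sched_top m _ a h1 h2]
    constructor <;> norm_num [owner2] <;> (try split_ifs) <;> (try simp only [Prod.mk.injEq]) <;> first | omega | (intros; exfalso; omega) | grind
  · rw [sched_c1]
    constructor <;> norm_num [owner2] <;> (try split_ifs) <;> (try simp only [Prod.mk.injEq]) <;> first | omega | (intros; exfalso; omega) | grind
  · rw [sched_c2]
    constructor <;> norm_num [owner2] <;> (try split_ifs) <;> (try simp only [Prod.mk.injEq]) <;> first | omega | (intros; exfalso; omega) | grind
  · rw [sched_bot m _ a h1]
    constructor <;> norm_num [owner2] <;> (try split_ifs) <;> (try simp only [Prod.mk.injEq]) <;> first | omega | (intros; exfalso; omega) | grind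
  · rw [sched_f]
    constructor <;> norm_num [owner2] <;> (try split_ifs) <;> (try simp only [Prod.mk.injEq]) <;> first | omega | (intros; exfalso; omega) | grind
  · rw [sched_e]
    constructor <;> norm_num [owner2] <;> (try split_ifs) <;> (try simp only [Prod.mk.injEq]) <;> first | omega | (intros; exfalso; omega) | grind
  · rw [sched_stay m _ hm v hs]
    unfold Stay at hs
    simp only [owner2, and_self]
    rcases hs with hs | hs | hs <;> (split_ifs <;> first | rfl | omega)

theorem owner_sched3 (m : ℕ) (hm : 1 ≤ m) (v : Node) (hv : v ∈ lineParticles m) :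
    owner3 m (sched m 3 v).1 = v ∧ owner3 m (sched m 3 v).2 = v := by
  rcases part_cases m v hv with ⟨a, h1, h2, rfl⟩ | rfl | rfl | ⟨a, h1, h2, rfl⟩ | rfl | rfl | hs
  · rw [sched_top m _ a h1 h2]
    constructor <;> norm_num [owner3] <;> (try split_ifs) <;> (try simp only [Prod.mk.injEq]) <;> first | omega | (intros; exfalso; omega) | grind
  · rw [sched_c1]
    constructor <;> norm_num [owner3] <;> (try split_ifs) <;> (try simp only [Prod.mk.injEq]) <;> first | omega | (intros; exfalso; omega) | grind
  · rw [sched_c2]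
    constructor <;> norm_num [owner3] <;> (try split_ifs) <;> (try simp only [Prod.mk.injEq]) <;> first | omega | (intros; exfalso; omega) | grind
  · rw [sched_bot m _ a h1]
    constructor <;> norm_num [owner3] <;> (try split_ifs) <;> (try simp only [Prod.mk.injEq]) <;> first | omega | (intros; exfalso; omega) | grind
  · rw [sched_f]
    constructor <;> norm_num [owner3] <;> (try split_ifs) <;> (try simp only [Prod.mk.injEq]) <;> first | omega | (intros; exfalso; omega) | grind
  · rw [sched_e]
    constructor <;> norm_num [owner3] <;> (try split_ifs) <;> (try simp only [Prod.mk.injEq]) <;> first | omega | (intros; exfalso; omega) | grind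
  · rw [sched_stay m _ hm v hs]
    unfold Stay at hs
    simp only [owner3, and_self]
    rcases hs with hs | hs | hs <;> (split_ifs <;> first | rfl | omega)

theorem owner_sched4 (m : ℕ) (hm : 1 ≤ m) (v : Node) (hv : v ∈ lineParticles m) :
    owner3 m (sched m 4 v).1 = v ∧ owner3 m (sched m 4 v).2 = v := by
  rcases part_cases m v hv with ⟨a, h1, h2, rfl⟩ | rfl | rfl | ⟨a, h1, h2, rfl⟩ | rfl | rfl | hs
  · rw [sched_top m _ a h1 h2]
    constructor <;> norm_num [owner3] <;> (try split_ifs) <;> (try simp only [Prod.mk.injEq]) <;> first | omega | (intros; exfalso; omega) | grind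
  · rw [sched_c1]
    constructor <;> norm_num [owner3] <;> (try split_ifs) <;> (try simp only [Prod.mk.injEq]) <;> first | omega | (intros; exfalso; omega) | grind
  · rw [sched_c2]
    constructor <;> norm_num [owner3] <;> (try split_ifs) <;> (try simp only [Prod.mk.injEq]) <;> first | omega | (intros; exfalso; omega) | grind
  · rw [sched_bot m _ a h1]
    constructor <;> norm_num [owner3] <;> (try split_ifs) <;> (try simp only [Prod.mk.injEq]) <;> first | omega | (intros; exfalso; omega) | grind
  · rw [sched_f]
    constructor <;> norm_num [owner3] <;> (try split_ifs) <;> (try simp only [Prod.mk.injEq]) <;> first | omega | (intros; exfalso; omega) | grind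
  · rw [sched_e]
    constructor <;> norm_num [owner3] <;> (try split_ifs) <;> (try simp only [Prod.mk.injEq]) <;> first | omega | (intros; exfalso; omega) | grind
  · rw [sched_stay m _ hm v hs]
    unfold Stay at hs
    simp only [owner3, and_self]
    rcases hs with hs | hs | hs <;> (split_ifs <;> first | rfl | omega)

theorem owner_sched (m : ℕ) (hm : 1 ≤ m) (t : ℕ) : ∃ o : Node → Node, ∀ v ∈ lineParticles m,
    o (sched m t v).1 = v ∧ o (sched m t v).2 = v := by
  rcases t_cases t with h | h | h | h | h
  · subst h
    exact ⟨id, fun v _ => by simp [sched]⟩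
  · subst h
    exact ⟨owner1 m, owner_sched1 m hm⟩
  · subst h
    exact ⟨owner2 m, owner_sched2 m hm⟩
  · subst h
    exact ⟨owner3 m, owner_sched3 m hm⟩
  · refine ⟨owner3 m, fun v hv => ?_⟩
    rw [sched_four m t h]
    exact owner_sched4 m hm v hv

theorem sched_notin (m : ℕ) (hm : 1 ≤ m) (t : ℕ) (v : Node) (hv : v ∈ lineParticles m) :
    (sched m t v).1 ∉ lineObject m ∧ (sched m t v).2 ∉ lineObject m := by
  simp only [mem_line]
  rcases part_cases m v hv with ⟨a, h1, h2, rfl⟩ | rfl | rfl | ⟨a, h1, h2, rfl⟩ | rfl | rfl | hs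
  · rw [sched_top m _ a h1 h2]
    split_ifs <;> constructor <;> dsimp only <;> omega
  · rw [sched_c1]
    split_ifs <;> constructor <;> dsimp only <;> omega
  · rw [sched_c2]
    split_ifs <;> constructor <;> dsimp only <;> omega
  · rw [sched_bot m _ a h1]
    split_ifs <;> constructor <;> dsimp only <;> omega
  · rw [sched_f]
    split_ifs <;> constructor <;> dsimp only <;> omega
  · rw [sched_e]
    split_ifs <;> constructor <;> dsimp only <;> omega
  · rw [sched_stay m _ hm v hs]
    unfold Stay at hs
    dsimp only; omega

theorem sched_final (m : ℕ) (hm : 1 ≤ m) (v : Node) (hv : v ∈ lineParticles m) :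
    Contracted (sched m 4 v) ∧ (sched m 4 v).1 ∈ layer (lineObject m) 1 ∧
      (sched m 4 v).2 ∈ layer (lineObject m) 1 := by
  simp only [mem_layer, Contracted]
  rcases part_cases m v hv with ⟨a, h1, h2, rfl⟩ | rfl | rfl | ⟨a, h1, h2, rfl⟩ | rfl | rfl | hs
  · rw [sched_top m _ a h1 h2]
    norm_num <;> omega
  · rw [sched_c1]
    norm_num <;> omega
  · rw [sched_c2]
    norm_num <;> omega
  · rw [sched_bot m _ a h1]
    norm_num <;> omega
  · rw [sched_f]
    norm_num <;> omega
  · rw [sched_e]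
    norm_num <;> omega
  · rw [sched_stay m _ hm v hs]
    unfold Stay at hs
    refine ⟨rfl, ?_, ?_⟩ <;> dsimp only <;> omega

/-- `n` is connected within `S` to the origin. -/
def Rch (S : Set Node) (n : Node) : Prop :=
  ∃ (h : n ∈ S) (h0 : ((0 : ℤ), (0 : ℤ)) ∈ S),
    (Geqt.induce S).Reachable ⟨n, h⟩ ⟨((0 : ℤ), (0 : ℤ)), h0⟩

theorem Rch.step {S : Set Node} {n k : Node} (h : Rch S k) (hn : n ∈ S) (ha : Geqt.Adj n k) :
    Rch S n := by
  obtain ⟨hk, h0, hr⟩ := h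
  refine ⟨hn, h0, SimpleGraph.Reachable.trans (SimpleGraph.Adj.reachable ?_) hr⟩
  exact ha

theorem conn_of_rch {S : Set Node} (h0 : ((0 : ℤ), (0 : ℤ)) ∈ S) (h : ∀ n ∈ S, Rch S n) :
    connectedSet S := by
  have : Nonempty S := ⟨⟨_, h0⟩⟩
  refine SimpleGraph.Connected.mk fun u v => ?_
  obtain ⟨_, _, h1⟩ := h u.1 u.2
  obtain ⟨_, _, h2⟩ := h v.1 v.2
  exact h1.trans h2.symm

theorem rch_line (m : ℕ) {S : Set Node} (hS : lineObject m ⊆ S) (n : Node) (hn : n ∈ lineObject m) :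
    Rch S n := by
  have key : ∀ k : ℕ, k ≤ 2 * m → Rch S ((k : ℤ), (0 : ℤ)) := by
    intro k
    induction k with
    | zero =>
      intro _
      have : ((0 : ℤ), (0 : ℤ)) ∈ S := hS ((mem_line m _).2 (by dsimp only; omega))
      exact ⟨this, this, SimpleGraph.Reachable.refl _⟩
    | succ k ih =>
      intro hk
      refine (ih (by omega)).step (hS ((mem_line m _).2 (by dsimp only; omega))) ?_
      rw [adj_iff]
      first | omega | (simp; done) | (simp; omega)
  obtain ⟨a, b⟩ := n
  rw [mem_line] at hn
  simp only at hn
  obtain ⟨h1, h2, rfl⟩ := hn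
  lift a to ℕ using h1
  exact key a (by omega)

theorem rch_layer (m : ℕ) {S : Set Node} (hS : lineObject m ⊆ S) (n : Node)
    (hn : n ∈ layer (lineObject m) 1) (hnS : n ∈ S) : Rch S n := by
  rw [mem_layer] at hn
  have h2 : ∃ w, w ∈ lineObject m ∧ Geqt.Adj n w := by
    simp only [mem_line, adj_iff]
    rcases hn with ⟨h, h', h''⟩ | ⟨h, h', h''⟩ | ⟨h, h' | h'⟩
    · by_cases hz : n.1 = -1
      · exact ⟨(n.1 + 1, 0), by dsimp only; omega⟩
      · exact ⟨(n.1, 0), by dsimp only; omega⟩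
    · by_cases hz : n.1 = 0
      · exact ⟨(n.1, 0), by dsimp only; omega⟩
      · exact ⟨(n.1 - 1, 0), by dsimp only; omega⟩
    · exact ⟨(n.1 + 1, 0), by dsimp only; omega⟩
    · exact ⟨(n.1 - 1, 0), by dsimp only; omega⟩
  obtain ⟨w, hw, ha⟩ := h2
  exact (rch_line m hS w hw).step hnS ha

/-- The occupied set under the schedule. -/
def occ (m t : ℕ) : Set Node :=
  {n | ∃ v ∈ lineParticles m, n = (sched m t v).1 ∨ n = (sched m t v).2}

/-- Except in round 2 (and the extra particle), each particle touches layer 1. -/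
theorem sched_touch (m : ℕ) (hm : 1 ≤ m) (t : ℕ) (ht : t ≠ 2) (v : Node)
    (hv : v ∈ lineParticles m) (hv2 : v.2 ≠ 2 ∨ 3 ≤ t) :
    (sched m t v).1 ∈ layer (lineObject m) 1 ∨ (sched m t v).2 ∈ layer (lineObject m) 1 := by
  simp only [mem_layer]
  rcases part_cases m v hv with ⟨a, h1, h2, rfl⟩ | rfl | rfl | ⟨a, h1, h2, rfl⟩ | rfl | rfl | hs
  · rw [sched_top m _ a h1 h2]
    split_ifs <;> first | (left; dsimp only; omega) | (right; dsimp only; omega) | (exfalso; dsimp only at hv2; omega)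
  · rw [sched_c1]
    split_ifs <;> first | (left; dsimp only; omega) | (right; dsimp only; omega) | (exfalso; dsimp only at hv2; omega)
  · rw [sched_c2]
    split_ifs <;> first | (left; dsimp only; omega) | (right; dsimp only; omega) | (exfalso; dsimp only at hv2; omega)
  · rw [sched_bot m _ a h1]
    split_ifs <;> first | (left; dsimp only; omega) | (right; dsimp only; omega) | (exfalso; dsimp only at hv2; omega)
  · rw [sched_f]
    split_ifs <;> first | (left; dsimp only; omega) | (right; dsimp only; omega) | (exfalso; dsimp only at hv2; omega)
  · rw [sched_e]
    split_ifs <;> first | (left; dsimp only; omega) | (right; dsimp only; omega) | (exfalso; dsimp only at hv2; omega)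
  · rw [sched_stay m _ hm v hs]
    left
    unfold Stay at hs
    dsimp only; omega

theorem rch_pair (m t : ℕ) {S : Set Node} (v : Node)
    (h1S : (sched m t v).1 ∈ S) (h2S : (sched m t v).2 ∈ S)
    (h : Rch S (sched m t v).1 ∨ Rch S (sched m t v).2) :
    Rch S (sched m t v).1 ∧ Rch S (sched m t v).2 := by
  rcases sched_shape m t v with hc | ha
  · have hc' : (sched m t v).1 = (sched m t v).2 := hc
    rw [hc'] at h ⊢
    tauto
  · rcases h with h | h
    · exact ⟨h, h.step h2S ha.symm⟩
    · exact ⟨h.step h1S ha, h⟩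

theorem occ_stay (m t : ℕ) (hm : 1 ≤ m) : ((m : ℤ), (1 : ℤ)) ∈ occ m t := by
  refine ⟨((m : ℤ), (1 : ℤ)), (mem_parts m _).2 (by dsimp only; omega), Or.inl ?_⟩
  simp only [sched]
  simp
  try (split_ifs <;> first | rfl | omega)

theorem occ_two_top (m : ℕ) (k : ℕ) (hk : k + 1 ≤ m) : ((m : ℤ) + k, (2 : ℤ)) ∈ occ m 2 := by
  by_cases h : k = 0
  · subst h
    refine ⟨((m : ℤ), (2 : ℤ)), (mem_parts m _).2 (by dsimp only; omega), Or.inl ?_⟩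
    simp [sched]
  · refine ⟨((m : ℤ) + k, (1 : ℤ)), (mem_parts m _).2 (by dsimp only; omega), Or.inl ?_⟩
    simp only [sched]
    simp
    try (split_ifs <;> first | rfl | omega)

theorem occ_two_bot (m : ℕ) (k : ℕ) (hk : k + 1 ≤ m) :
    ((m : ℤ) + 2 + k, (-2 : ℤ)) ∈ occ m 2 := by
  refine ⟨((m : ℤ) + 2 + k, (-1 : ℤ)), (mem_parts m _).2 (by dsimp only; omega), Or.inl ?_⟩
  simp only [sched]
  simp
  try (split_ifs <;> first | rfl | omega)

theorem occ_two_f (m : ℕ) (hm : 1 ≤ m) : ((m : ℤ) + 1, (-1 : ℤ)) ∈ occ m 2 := by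
  refine ⟨((m : ℤ) + 1, (-1 : ℤ)), (mem_parts m _).2 (by dsimp only; omega), Or.inl ?_⟩
  simp [sched]

theorem occ_two_c (m : ℕ) : (2 * (m : ℤ) + 1, (0 : ℤ)) ∈ occ m 2 := by
  refine ⟨(2 * (m : ℤ) + 1, (0 : ℤ)), (mem_parts m _).2 (by dsimp only; omega), Or.inl ?_⟩
  simp [sched]

theorem sched_two (m : ℕ) (hm : 1 ≤ m) (v : Node) (hv : v ∈ lineParticles m) :
    (sched m 2 v).1 ∈ layer (lineObject m) 1 ∨
    ((sched m 2 v).1.2 = 2 ∧ (m : ℤ) ≤ (sched m 2 v).1.1 ∧ (sched m 2 v).1.1 ≤ 2 * m - 1) ∨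
    ((sched m 2 v).1.2 = -2 ∧ (m : ℤ) + 2 ≤ (sched m 2 v).1.1 ∧
      (sched m 2 v).1.1 ≤ 2 * m + 1) ∨
    ((sched m 2 v).1.2 = 1 ∧ (sched m 2 v).1.1 = 2 * m + 1) := by
  simp only [mem_layer]
  rcases part_cases m v hv with ⟨a, h1, h2, rfl⟩ | rfl | rfl | ⟨a, h1, h2, rfl⟩ | rfl | rfl | hs
  · rw [sched_top m _ a h1 h2]
    norm_num <;> omega
  · rw [sched_c1]
    norm_num <;> omega
  · rw [sched_c2]
    norm_num <;> omega
  · rw [sched_bot m _ a h1]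
    norm_num <;> omega
  · rw [sched_f]
    norm_num <;> omega
  · rw [sched_e]
    norm_num <;> omega
  · rw [sched_stay m _ hm v hs]
    left
    unfold Stay at hs
    dsimp only; omega

set_option maxHeartbeats 1000000 in
theorem occ_conn (m : ℕ) (hm : 1 ≤ m) (t : ℕ) : connectedSet (occ m t ∪ lineObject m) := by
  have hS : lineObject m ⊆ occ m t ∪ lineObject m := Set.subset_union_right
  refine conn_of_rch (hS ((mem_line m _).2 (by dsimp only; omega))) ?_
  suffices H : ∀ v ∈ lineParticles m, Rch (occ m t ∪ lineObject m) (sched m t v).1 ∨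
      Rch (occ m t ∪ lineObject m) (sched m t v).2 by
    rintro n (⟨v, hv, hn⟩ | hn)
    · have := rch_pair m t v (Or.inl ⟨v, hv, Or.inl rfl⟩) (Or.inl ⟨v, hv, Or.inr rfl⟩) (H v hv)
      rcases hn with rfl | rfl
      · exact this.1
      · exact this.2
    · exact rch_line m hS n hn
  intro v hv
  have hm1 : Rch (occ m t ∪ lineObject m) ((m : ℤ), (1 : ℤ)) :=
    rch_layer m hS _ ((mem_layer m _).2 (by dsimp only; omega)) (Or.inl (occ_stay m t hm))
  have m1 : (sched m t v).1 ∈ occ m t ∪ lineObject m := Or.inl ⟨v, hv, Or.inl rfl⟩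
  have m2 : (sched m t v).2 ∈ occ m t ∪ lineObject m := Or.inl ⟨v, hv, Or.inr rfl⟩
  by_cases ht : t = 2
  · subst ht
    left
    have top : ∀ k : ℕ, k + 1 ≤ m → Rch (occ m 2 ∪ lineObject m) ((m : ℤ) + k, (2 : ℤ)) := by
      intro k
      induction k with
      | zero =>
        intro hk
        refine hm1.step (Or.inl (occ_two_top m 0 hk)) ?_
        rw [adj_iff]; simp
      | succ k ih =>
        intro hk
        refine (ih (by omega)).step (Or.inl (occ_two_top m (k + 1) hk)) ?_
        rw [adj_iff]; first | omega | (simp; done) | (simp; omega)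
    have bot : ∀ k : ℕ, k + 1 ≤ m → Rch (occ m 2 ∪ lineObject m) ((m : ℤ) + 2 + k, (-2 : ℤ)) := by
      intro k
      induction k with
      | zero =>
        intro hk
        have hf : Rch (occ m 2 ∪ lineObject m) ((m : ℤ) + 1, (-1 : ℤ)) :=
          rch_layer m hS _ ((mem_layer m _).2 (by dsimp only; omega)) (Or.inl (occ_two_f m hm))
        refine hf.step (Or.inl (occ_two_bot m 0 hk)) ?_
        rw [adj_iff]; first | omega | (simp; done) | (simp; omega)
      | succ k ih =>
        intro hk
        refine (ih (by omega)).step (Or.inl (occ_two_bot m (k + 1) hk)) ?_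
        rw [adj_iff]; first | omega | (simp; done) | (simp; omega)
    rcases sched_two m hm v hv with h | ⟨h, h', h''⟩ | ⟨h, h', h''⟩ | ⟨h, h'⟩
    · exact rch_layer m hS _ h m1
    · obtain ⟨k, hk⟩ := Int.eq_ofNat_of_zero_le (sub_nonneg.2 h')
      have := top k (by omega)
      convert this using 1
      exact Prod.ext (by dsimp only; omega) h
    · obtain ⟨k, hk⟩ := Int.eq_ofNat_of_zero_le (sub_nonneg.2 h')
      have := bot k (by omega)
      convert this using 1
      exact Prod.ext (by dsimp only; omega) h
    · have hc : Rch (occ m 2 ∪ lineObject m) (2 * (m : ℤ) + 1, (0 : ℤ)) :=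
        rch_layer m hS _ ((mem_layer m _).2 (by dsimp only; omega)) (Or.inl (occ_two_c m))
      refine hc.step m1 ?_
      rw [adj_iff]; dsimp only; omega
  · by_cases h2 : v.2 ≠ 2 ∨ 3 ≤ t
    · rcases sched_touch m hm t ht v hv h2 with h | h
      · exact Or.inl (rch_layer m hS _ h m1)
      · exact Or.inr (rch_layer m hS _ h m2)
    · left
      refine hm1.step m1 ?_
      rw [mem_parts] at hv
      have h22 : v.2 = 2 := by omega
      have h3 : v.1 = m := by omega
      have h4 : (sched m t v).1 = v := by
        have : t ≤ 2 := by omega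
        simp [sched, h22, this]
      rw [h4, adj_iff]
      dsimp only; omega

theorem occ_eq (m t : ℕ) :
    occupiedAt (lineInstance m) (fun t p => sched m t p.1) t = occ m t := by
  ext n
  simp only [occupiedAt, nodesOf, Set.mem_iUnion, Set.mem_insert_iff, Set.mem_singleton_iff, occ,
    Set.mem_setOf_eq]
  constructor
  · rintro ⟨p, hp⟩
    exact ⟨p.1, p.2, hp⟩
  · rintro ⟨v, hv, h⟩
    exact ⟨⟨v, hv⟩, h⟩

theorem line_exec (m : ℕ) (hm : 1 ≤ m) :
    ∃ e : ℕ → Pt (lineInstance m) → Node × Node,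
      IsExec (lineInstance m) e ∧ ConnectedExec (lineInstance m) e ∧
        SolvesIn (lineInstance m) e 5 := by
  refine ⟨fun t p => sched m t p.1, ⟨?_, ?_, ?_, ?_, ?_⟩, ?_, ?_, ?_, ?_⟩
  · intro p
    simp [sched]
  · intro t p
    exact sched_shape m t p.1
  · intro t p
    exact sched_move m t p.1
  · intro t p q hpq
    rw [Set.eq_empty_iff_forall_notMem]
    rintro n ⟨h1, h2⟩
    obtain ⟨o, ho⟩ := owner_sched m hm t
    have hp := ho p.1 p.2
    have hq := ho q.1 q.2
    apply hpq
    apply Subtype.ext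
    have e1 : o n = p.1 := by
      rcases h1 with h | h
      · rw [h]; exact hp.1
      · rw [Set.mem_singleton_iff.1 h]; exact hp.2
    have e2 : o n = q.1 := by
      rcases h2 with h | h
      · rw [h]; exact hq.1
      · rw [Set.mem_singleton_iff.1 h]; exact hq.2
    exact e1.symm.trans e2
  · intro t
    rw [occ_eq, Set.eq_empty_iff_forall_notMem]
    rintro n ⟨⟨v, hv, h⟩, h2⟩
    have := sched_notin m hm t v hv
    rcases h with rfl | rfl
    · exact this.1 h2
    · exact this.2 h2
  · intro t
    rw [occ_eq]
    exact occ_conn m hm t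
  · intro p
    have := (sched_final m hm p.1 p.2).1
    rw [← sched_four m 5 (by omega)] at this
    exact this
  · rw [occ_eq]
    intro v hv _ w hw
    obtain ⟨u, hu, h⟩ := hw
    rw [sched_four m 5 (by omega)] at h
    have h1 := sched_final m hm u hu
    have h2 : w ∈ layer (lineObject m) 1 := by
      rcases h with rfl | rfl
      · exact h1.2.1
      · exact h1.2.2
    have h3 : gdistSet w (lineObject m) = 1 := h2
    have h4 := gdistSet_pos m v hv
    change gdistSet w (lineObject m) ≤ gdistSet v (lineObject m)
    omega
  · intro t ht
    funext p
    change sched m t p.1 = sched m 5 p.1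
    rw [sched_four m t (by omega), sched_four m 5 (by omega)]

/-- For the line instance — the object a straight line, the
particles occupying every node of layer 1 except one node below the object
equidistant from its two ends, plus one additional particle in layer 2 above
the object equidistant from its two ends — the coating problem can be solved
in 5 rounds while keeping the particle system connected throughout; in
particular, `OPT(P,O) ≤ 5 = O(1)`, independent of the length of the object. -/
theorem stmt3 : ∀ m : ℕ, 1 ≤ m →
    (∃ e : ℕ → Pt (lineInstance m) → Node × Node,
      IsExec (lineInstance m) e ∧ ConnectedExec (lineInstance m) e ∧
        SolvesIn (lineInstance m) e 5) ∧
    OPT (lineInstance m) ≤ (5 : ℕ∞) := by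
  intro m hm
  have h := line_exec m hm
  refine ⟨h, ?_⟩
  exact sInf_le ⟨5, rfl, h⟩
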